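/- Let n ∈ ℕ and let s, m, ℓ be nonnegative integers with s + m + ℓ = n − 2, satisfying s ≤ ℓ − n^{3/4} and ℓ ≥ n^{3/4}. Consider a uniformly random arrangement of these n − 2 elements (s small, m medium, ℓ large), and let sz = n^{2/3} (assume sz ≤ n − 2). Let s' and ℓ' denote the numbers of small and large elements, respectively, among the first sz positions of the arrangement. Then Pr(s' > ℓ') ≤ exp(−2·n^{1/6}/9). -/

import Mathlib

/-- Pointwise product sums over a swap-invariant family are dominated. -/
lemma swap_dom {N : ℕ} (Ω : Finset (Fin N → Fin 3))
    (hΩ : ∀ (σ : Equiv.Perm (Fin N)), ∀ f ∈ Ω, f ∘ σ ∈ Ω)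
    (w : Fin 3 → ℝ) (hw : ∀ i, 0 ≤ w i) (S : Finset (Fin N)) (a : Fin N) (ha : a ∉ S)
    (i : Fin N) :
    ∑ f ∈ Ω, ∏ j ∈ insert a S, w (f j) ≤ ∑ f ∈ Ω, w (f i) * ∏ j ∈ S, w (f j) := by
  have key : ∀ g : (Fin N → Fin 3) → ℝ,
      ∑ f ∈ Ω, g (f ∘ Equiv.swap i a) = ∑ f ∈ Ω, g f := by
    intro g
    refine Finset.sum_bij' (fun f _ => f ∘ Equiv.swap i a) (fun f _ => f ∘ Equiv.swap i a)
      (fun f hf => hΩ _ f hf) (fun f hf => hΩ _ f hf) ?_ ?_ ?_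
    · intro f _
      funext x
      simp
    · intro f _
      funext x
      simp
    · intro f _
      rfl
  by_cases hi : i ∈ S
  · have hne : ∀ j ∈ S.erase i, Equiv.swap i a j = j := by
      intro j hj
      rw [Finset.mem_erase] at hj
      apply Equiv.swap_apply_of_ne_of_ne hj.1
      rintro rfl
      exact ha hj.2
    have h1 := key (fun f => w (f i) * ∏ j ∈ S, w (f j))
    have h2 : ∀ f : Fin N → Fin 3, ∏ j ∈ S, w (f j) = w (f i) * ∏ j ∈ S.erase i, w (f j) :=
      fun f => (Finset.mul_prod_erase S (fun j => w (f j)) hi).symm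
    have h3 : ∀ f : Fin N → Fin 3,
        ∏ j ∈ S.erase i, w ((f ∘ Equiv.swap i a) j) = ∏ j ∈ S.erase i, w (f j) := by
      intro f
      apply Finset.prod_congr rfl
      intro j hj
      simp [hne j hj]
    simp only [h2, h3] at h1
    simp only [Function.comp, Equiv.swap_apply_left] at h1
    simp only [Finset.prod_insert ha, h2]
    have h4 : ∑ f ∈ Ω, 2 * (w (f a) * (w (f i) * ∏ j ∈ S.erase i, w (f j))) ≤
        ∑ f ∈ Ω, (w (f a) * (w (f a) * ∏ j ∈ S.erase i, w (f j)) +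
          w (f i) * (w (f i) * ∏ j ∈ S.erase i, w (f j))) := by
      apply Finset.sum_le_sum
      intro f _
      have hp : 0 ≤ ∏ j ∈ S.erase i, w (f j) := Finset.prod_nonneg (fun j _ => hw _)
      nlinarith [mul_nonneg hp (sq_nonneg (w (f a) - w (f i)))]
    rw [Finset.sum_add_distrib, h1, ← Finset.mul_sum] at h4
    linarith
  · have h1 := key (fun f => w (f i) * ∏ j ∈ S, w (f j))
    rw [← h1]
    apply le_of_eq
    apply Finset.sum_congr rfl
    intro f _
    rw [Finset.prod_insert ha]
    simp only [Function.comp, Equiv.swap_apply_left]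
    congr 1
    apply Finset.prod_congr rfl
    intro j hj
    rw [Equiv.swap_apply_of_ne_of_ne]
    · rintro rfl
      exact hi hj
    · rintro rfl
      exact ha hj

lemma prod_mean_bound {N : ℕ} (hN : 0 < N) (Ω : Finset (Fin N → Fin 3))
    (hΩ : ∀ (σ : Equiv.Perm (Fin N)), ∀ f ∈ Ω, f ∘ σ ∈ Ω)
    (w : Fin 3 → ℝ) (hw : ∀ i, 0 ≤ w i) (T : ℝ) (hT : ∀ f ∈ Ω, ∑ i, w (f i) = T * N)
    (hT0 : 0 ≤ T) (S : Finset (Fin N)) :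
    ∑ f ∈ Ω, ∏ j ∈ S, w (f j) ≤ Ω.card * T ^ S.card := by
  induction S using Finset.induction_on with
  | empty => simp
  | insert a S ha ih =>
    have hNr : (0 : ℝ) < N := by exact_mod_cast hN
    have h1 : ∑ _i : Fin N, ∑ f ∈ Ω, ∏ j ∈ insert a S, w (f j) ≤
        ∑ i : Fin N, ∑ f ∈ Ω, w (f i) * ∏ j ∈ S, w (f j) :=
      Finset.sum_le_sum (fun i _ => swap_dom Ω hΩ w hw S a ha i)
    rw [Finset.sum_comm (s := Finset.univ) (t := Ω)
      (f := fun i f => w (f i) * ∏ j ∈ S, w (f j))] at h1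
    have h2 : ∑ f ∈ Ω, ∑ i, w (f i) * ∏ j ∈ S, w (f j) =
        T * N * ∑ f ∈ Ω, ∏ j ∈ S, w (f j) := by
      rw [Finset.mul_sum]
      apply Finset.sum_congr rfl
      intro f hf
      rw [← Finset.sum_mul, hT f hf]
    rw [h2, Finset.sum_const, Finset.card_univ, Fintype.card_fin, nsmul_eq_mul] at h1
    rw [Finset.card_insert_of_notMem ha, pow_succ]
    have h3 : ∑ f ∈ Ω, ∏ j ∈ insert a S, w (f j) ≤ T * ∑ f ∈ Ω, ∏ j ∈ S, w (f j) := by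
      refine le_of_mul_le_mul_left ?_ hNr
      linarith
    have h4 := mul_le_mul_of_nonneg_left ih hT0
    linarith

lemma weight_split (a r : ℝ) (x : Fin 3) :
    (![a, 1, r] : Fin 3 → ℝ) x = (if x = 0 then a else 1) * (if x = 2 then r else 1) := by
  fin_cases x <;> simp

lemma prod_weight {N : ℕ} (a r : ℝ) (f : Fin N → Fin 3) (S : Finset (Fin N)) :
    ∏ j ∈ S, (![a, 1, r] : Fin 3 → ℝ) (f j) =
      a ^ (S.filter (fun j => f j = 0)).card * r ^ (S.filter (fun j => f j = 2)).card := by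
  simp only [weight_split, Finset.prod_mul_distrib, Finset.prod_ite, Finset.prod_const, one_pow,
    mul_one]

lemma weight_split_add (a r : ℝ) (x : Fin 3) :
    (![a, 1, r] : Fin 3 → ℝ) x =
      (if x = 0 then a else 0) + (if x = 1 then 1 else 0) + (if x = 2 then r else 0) := by
  fin_cases x <;> simp

lemma sum_weight {N : ℕ} (a r : ℝ) (f : Fin N → Fin 3) :
    ∑ j, (![a, 1, r] : Fin 3 → ℝ) (f j) =
      (Finset.univ.filter (fun j => f j = 0)).card * a +
      (Finset.univ.filter (fun j => f j = 1)).card +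
      (Finset.univ.filter (fun j => f j = 2)).card * r := by
  simp only [weight_split_add, Finset.sum_add_distrib, Finset.sum_ite, Finset.sum_const,
    nsmul_eq_mul, mul_zero, add_zero, mul_one]

lemma card_comp {N : ℕ} (f : Fin N → Fin 3) (σ : Equiv.Perm (Fin N)) (c : Fin 3) :
    (Finset.univ.filter (fun j => (f ∘ σ) j = c)).card =
      (Finset.univ.filter (fun j => f j = c)).card := by
  apply Finset.card_bij (fun j _ => σ j)
  · intro j hj
    simpa using hj
  · intro j _ k _ h
    exact σ.injective h
  · intro b hb
    refine ⟨σ.symm b, ?_, by simp⟩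
    simpa using hb

lemma mean_bound (s m l N δ : ℝ) (hm : 0 ≤ m) (hN : s + m + l = N)
    (hδ0 : 0 ≤ δ) (hδ : l - s = δ * N) :
    s * (1 + δ) + m + l * (1 + δ)⁻¹ ≤ (1 - δ ^ 2 / 2) * N := by
  have hpos : 0 < 1 + δ := by linarith
  rw [← sub_nonneg]
  have hl : l = (N - m + δ * N) / 2 := by linarith
  have hs : s = (N - m - δ * N) / 2 := by linarith
  have : (1 - δ ^ 2 / 2) * N - (s * (1 + δ) + m + l * (1 + δ)⁻¹) =
      m * δ ^ 2 / (2 * (1 + δ)) := by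
    rw [hl, hs]
    field_simp
    ring
  rw [this]
  positivity

lemma analytic_bound (n k : ℕ) (N δ : ℝ) (hn : 1 ≤ n)
    (hk : k = ⌊(n : ℝ) ^ ((2 : ℝ) / 3)⌋₊) (hN : 0 < N) (hNn : N ≤ n)
    (hδ : (n : ℝ) ^ ((3 : ℝ) / 4) ≤ δ * N) (hδ0 : 0 ≤ δ) :
    2 * (n : ℝ) ^ ((1 : ℝ) / 6) / 9 ≤ k * (δ ^ 2 / 2) := by
  have hn1 : (1 : ℝ) ≤ n := by exact_mod_cast hn
  have hn0 : (0 : ℝ) < n := by linarith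
  have hx : (1 : ℝ) ≤ (n : ℝ) ^ ((2 : ℝ) / 3) := Real.one_le_rpow hn1 (by norm_num)
  have hk1 : (n : ℝ) ^ ((2 : ℝ) / 3) / 2 ≤ k := by
    have h1 := Nat.lt_floor_add_one ((n : ℝ) ^ ((2 : ℝ) / 3))
    have h2 : (1 : ℝ) ≤ k := by
      have : 1 ≤ k := by
        rw [hk]
        exact Nat.le_floor (by simpa using hx)
      exact_mod_cast this
    rw [← hk] at h1
    linarith
  have hd : (n : ℝ) ^ (-(1 : ℝ) / 4) ≤ δ := by
    have h1 : (n : ℝ) ^ (-(1 : ℝ) / 4) * n = (n : ℝ) ^ ((3 : ℝ) / 4) := by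
      nth_rewrite 2 [← Real.rpow_one (n : ℝ)]
      rw [← Real.rpow_add hn0]
      norm_num
    have h2 : δ * N ≤ δ * n := mul_le_mul_of_nonneg_left hNn hδ0
    exact le_of_mul_le_mul_right (by linarith) hn0
  have hd2 : (n : ℝ) ^ (-(1 : ℝ) / 2) ≤ δ ^ 2 := by
    have h0 : 0 ≤ (n : ℝ) ^ (-(1 : ℝ) / 4) := by positivity
    have : (n : ℝ) ^ (-(1 : ℝ) / 2) = ((n : ℝ) ^ (-(1 : ℝ) / 4)) ^ 2 := by
      rw [sq, ← Real.rpow_add hn0]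
      norm_num
    rw [this]
    gcongr
  have h6 : (n : ℝ) ^ ((1 : ℝ) / 6) = (n : ℝ) ^ ((2 : ℝ) / 3) * (n : ℝ) ^ (-(1 : ℝ) / 2) := by
    rw [← Real.rpow_add hn0]
    norm_num
  have h7 : (n : ℝ) ^ ((2 : ℝ) / 3) / 2 * (n : ℝ) ^ (-(1 : ℝ) / 2) ≤ k * δ ^ 2 := by
    gcongr
  have h8 : 0 ≤ (n : ℝ) ^ ((1 : ℝ) / 6) := by positivity
  linarith

/-- The sampling lemma: for a uniformly random arrangement of `n−2` elements with
`s` small (`= 0`), `m` medium (`= 1`) and `ℓ` large (`= 2`) elements, where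
`s ≤ ℓ − n^{3/4}` and `ℓ ≥ n^{3/4}`, the probability that among the first
`sz = n^{2/3}` positions there are more small than large elements is at most
`exp(−2·n^{1/6}/9)`. -/
theorem sampling_guess_error (n s m l : ℕ) (hsum : s + m + l = n - 2)
    (hsl : (s : ℝ) ≤ (l : ℝ) - (n : ℝ) ^ ((3 : ℝ) / 4))
    (hl : (n : ℝ) ^ ((3 : ℝ) / 4) ≤ (l : ℝ))
    (hsz : ⌊(n : ℝ) ^ ((2 : ℝ) / 3)⌋₊ ≤ n - 2) :
    (let sz := ⌊(n : ℝ) ^ ((2 : ℝ) / 3)⌋₊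
     let Ω := Finset.univ.filter (fun f : Fin (n - 2) → Fin 3 =>
       (Finset.univ.filter (fun j => f j = 0)).card = s ∧
       (Finset.univ.filter (fun j => f j = 1)).card = m ∧
       (Finset.univ.filter (fun j => f j = 2)).card = l)
     ((Ω.filter (fun f =>
        (Finset.univ.filter (fun j : Fin (n - 2) => (j : ℕ) < sz ∧ f j = 2)).card <
        (Finset.univ.filter (fun j : Fin (n - 2) => (j : ℕ) < sz ∧ f j = 0)).card)).card : ℝ) /
      ((Ω.card : ℝ))) ≤
    Real.exp (-2 * (n : ℝ) ^ ((1 : ℝ) / 6) / 9) := by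
  extract_lets sz Ω
  rcases Nat.eq_zero_or_pos n with hn | hn
  · have : (n : ℝ) ^ ((1 : ℝ) / 6) = 0 := by
      subst hn
      norm_num
    rw [this]
    simp only [mul_zero, zero_div, Real.exp_zero]
    apply div_le_one_of_le₀
    · exact_mod_cast Finset.card_filter_le _ _
    · positivity
  have hn1 : (1 : ℝ) ≤ n := by exact_mod_cast hn
  have hx : (1 : ℝ) ≤ (n : ℝ) ^ ((3 : ℝ) / 4) := Real.one_le_rpow hn1 (by norm_num)
  have hl1 : 1 ≤ l := by
    have : (1 : ℝ) ≤ l := by linarith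
    exact_mod_cast this
  have hN : 0 < n - 2 := by omega
  have hNr : (0 : ℝ) < ((n - 2 : ℕ) : ℝ) := by exact_mod_cast hN
  have hNn : ((n - 2 : ℕ) : ℝ) ≤ n := by exact_mod_cast Nat.sub_le n 2
  obtain ⟨δ, hδ⟩ : ∃ δ : ℝ, δ = ((l : ℝ) - s) / ((n - 2 : ℕ) : ℝ) := ⟨_, rfl⟩
  have hδN : (l : ℝ) - s = δ * ((n - 2 : ℕ) : ℝ) := by
    rw [hδ]
    field_simp
  have hδ0 : 0 ≤ δ := by
    rw [hδ]
    apply div_nonneg _ hNr.le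
    linarith
  have hA : 0 < 1 + δ := by linarith
  have hsumr : (s : ℝ) + m + l = ((n - 2 : ℕ) : ℝ) := by exact_mod_cast hsum
  have hmean := mean_bound s m l _ δ (by positivity) hsumr hδ0 hδN
  obtain ⟨T, hT⟩ : ∃ T : ℝ, T = (s * (1 + δ) + m + l * (1 + δ)⁻¹) / ((n - 2 : ℕ) : ℝ) := ⟨_, rfl⟩
  have hTN : s * (1 + δ) + m + l * (1 + δ)⁻¹ = T * ((n - 2 : ℕ) : ℝ) := by
    rw [hT]
    field_simp
  have hT0 : 0 ≤ T := by
    rw [hT]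
    positivity
  have hTle : T ≤ Real.exp (-(δ ^ 2 / 2)) := by
    have h1 : T ≤ 1 - δ ^ 2 / 2 := by
      rw [hTN] at hmean
      exact le_of_mul_le_mul_right hmean hNr
    have h2 := Real.add_one_le_exp (-(δ ^ 2 / 2))
    linarith
  let S : Finset (Fin (n - 2)) := Finset.univ.filter (fun j => (j : ℕ) < sz)
  have hS : S.card = sz := by
    have := Fin.card_filter_val_lt (n := n - 2) (m := sz)
    simp only [S]
    rw [this]
    exact min_eq_right hsz
  have hb := prod_mean_bound hN Ω (by
      intro σ f hf
      simp only [Ω, Finset.mem_filter, Finset.mem_univ, true_and] at hf ⊢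
      simp only [card_comp]
      exact hf) ![1 + δ, 1, (1 + δ)⁻¹] (by
      intro i
      fin_cases i
      · exact hA.le
      · exact zero_le_one
      · exact (inv_pos.2 hA).le) T (by
      intro f hf
      simp only [Ω, Finset.mem_filter, Finset.mem_univ, true_and] at hf
      rw [sum_weight, hf.1, hf.2.1, hf.2.2, hTN]) hT0 S
  rw [hS] at hb
  have hnn : ∀ f : Fin (n - 2) → Fin 3,
      0 ≤ ∏ j ∈ S, (![1 + δ, 1, (1 + δ)⁻¹] : Fin 3 → ℝ) (f j) := by
    intro f
    rw [prod_weight]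
    positivity
  have hpow : T ^ sz ≤ Real.exp (-2 * (n : ℝ) ^ ((1 : ℝ) / 6) / 9) := by
    have h1 : T ^ sz ≤ Real.exp (-(δ ^ 2 / 2)) ^ sz := pow_le_pow_left₀ hT0 hTle _
    refine h1.trans ?_
    rw [← Real.exp_nat_mul]
    apply Real.exp_le_exp.2
    have := analytic_bound n sz _ δ hn rfl hNr hNn (by linarith) hδ0
    linarith
  refine div_le_of_le_mul₀ (Nat.cast_nonneg _) (Real.exp_pos _).le ?_
  refine le_trans ?_ (hb.trans (by
    rw [mul_comm]
    exact mul_le_mul_of_nonneg_right hpow (Nat.cast_nonneg _)))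
  rw [Finset.card_eq_sum_ones]
  push_cast
  refine le_trans (Finset.sum_le_sum (fun f hf => ?_))
    (Finset.sum_le_sum_of_subset_of_nonneg (Finset.filter_subset _ Ω) (fun f _ _ => hnn f))
  have hlt := (Finset.mem_filter.1 hf).2
  rw [prod_weight]
  simp only [S, Finset.filter_filter]
  rw [inv_pow, ← div_eq_mul_inv, one_le_div (by positivity)]
  exact pow_le_pow_right₀ (by linarith) hlt.le
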